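/- arXiv:2212.12448 — 5 statements merged into one kernel-verified Lean document; each statement's English description precedes it below -/
import Mathlib

section
/- (Well-posedness, Theorem 3.4) In the abstract four-field Biot setting with the lifting hypotheses and the completeness hypotheses, for every linear functional f on X that is bounded with respect to ‖·‖_X, there exists a unique x ∈ X such that 𝒜(x, x̃) = f(x̃) for all x̃ ∈ X, and it satisfies ‖x‖_X ≤ C · sup over nonzero x̃ ∈ X of f(x̃)/‖x̃‖_X, where C depends only on α_u, β_r, β_u, β_q (independent of μ, λ, K, δ, c₀, α). -/
open RealInnerProductSpace

noncomputable section

variable {R U Q P : Type*}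
  [NormedAddCommGroup R] [InnerProductSpace ℝ R]
  [NormedAddCommGroup U] [InnerProductSpace ℝ U]
  [NormedAddCommGroup Q] [InnerProductSpace ℝ Q]
  [NormedAddCommGroup P] [InnerProductSpace ℝ P]

/-- The weight `η + c₀`, where `η := α²/(2μ+λ) + δ²K`. -/
def etaC (μ lam K δ c₀ α : ℝ) : ℝ := α ^ 2 / (2 * μ + lam) + δ ^ 2 * K + c₀

/-- The parameter-weighted norm `‖·‖_X` on `X := R × U × Q × P`. -/
def Xnorm (μ lam K δ c₀ α : ℝ) (C : R →ₗ[ℝ] U) (D : U →ₗ[ℝ] P) (E : Q →ₗ[ℝ] P)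
    (x : R × U × Q × P) : ℝ :=
  Real.sqrt (μ⁻¹ * (‖x.1‖ ^ 2 + ‖C x.1‖ ^ 2) + μ * ‖x.2.1‖ ^ 2
    + (2 * μ + lam) * ‖D x.2.1‖ ^ 2 + K⁻¹ * ‖x.2.2.1‖ ^ 2
    + δ ^ 2 / etaC μ lam K δ c₀ α * ‖E x.2.2.1‖ ^ 2
    + etaC μ lam K δ c₀ α * ‖x.2.2.2‖ ^ 2)

/-- The Biot bilinear form `𝒜` on `X := R × U × Q × P`. -/
def biotForm (μ lam K δ c₀ α : ℝ) (C : R →ₗ[ℝ] U) (D : U →ₗ[ℝ] P) (E : Q →ₗ[ℝ] P)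
    (x y : R × U × Q × P) : ℝ :=
  μ⁻¹ * ⟪x.1, y.1⟫ + (2 * μ + lam) * ⟪D x.2.1, D y.2.1⟫
    + K⁻¹ * ⟪x.2.2.1, y.2.2.1⟫ + c₀ * ⟪x.2.2.2, y.2.2.2⟫
    + ⟪C x.1, y.2.1⟫ + ⟪α • D x.2.1 + δ • E x.2.2.1, y.2.2.2⟫
    - ⟪C y.1, x.2.1⟫ - ⟪α • D y.2.1 + δ • E y.2.2.1, x.2.2.2⟫

section BilinearForm

open InnerProductSpace

/-- The Babuška–Nečas theorem on a real Hilbert space: a bounded bilinear form which is bounded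
below in its first argument and nondegenerate in its second represents every functional. -/
theorem exists_eq_of_boundedBelow_of_nondegenerate
    {H : Type*} [NormedAddCommGroup H] [InnerProductSpace ℝ H] [CompleteSpace H]
    (B : H →L[ℝ] H →L[ℝ] ℝ) (c : ℝ) (hbelow : ∀ v, ‖v‖ ≤ c * ‖B v‖)
    (hnondeg : ∀ w, (∀ v, B v w = 0) → w = 0) (φ : H →L[ℝ] ℝ) : ∃ v, B v = φ := by
  set T := continuousLinearMapOfBilin (𝕜 := ℝ) B
  have hTB : ∀ v w, ⟪T v, w⟫ = B v w := continuousLinearMapOfBilin_apply B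
  have hnorm : ∀ v, ‖B v‖ ≤ ‖T v‖ := fun v =>
    ContinuousLinearMap.opNorm_le_bound _ (norm_nonneg _) fun w => by
      rw [← hTB]; exact norm_inner_le_norm _ _
  have hanti : AntilipschitzWith c.toNNReal T := by
    refine ContinuousLinearMap.antilipschitz_of_bound T fun v => ?_
    calc ‖v‖ ≤ c * ‖B v‖ := hbelow v
      _ ≤ c.toNNReal * ‖B v‖ := by gcongr; exact Real.le_coe_toNNReal c
      _ ≤ c.toNNReal * ‖T v‖ := by gcongr; exact hnorm v
  have := (hanti.isClosed_range T.uniformContinuous).completeSpace_coe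
  have htop : T.range = ⊤ := by
    have : CompleteSpace T.range := this
    rw [← T.range.orthogonal_orthogonal, Submodule.eq_top_iff']
    intro v w hw
    obtain rfl : w = 0 := hnondeg w fun v => by
      rw [← hTB]; exact hw _ ⟨v, rfl⟩
    exact inner_zero_left _
  obtain ⟨v, hv⟩ : (toDual ℝ H).symm φ ∈ T.range := htop ▸ Submodule.mem_top
  refine ⟨v, ContinuousLinearMap.ext fun w => ?_⟩
  rw [← hTB]
  exact (congrArg (⟪·, w⟫) hv).trans (toDual_symm_apply)

end BilinearForm

section GraphSpace

variable {V W : Type*} [NormedAddCommGroup V] [InnerProductSpace ℝ V]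
  [NormedAddCommGroup W] [InnerProductSpace ℝ W]

/-- The graph of a linear map, as a subspace of the Hilbert sum: the domain with its graph norm. -/
abbrev graphSpace (T : V →ₗ[ℝ] W) : Submodule ℝ (WithLp 2 (V × W)) :=
  T.graph.comap (WithLp.linearEquiv 2 ℝ (V × W)).toLinearMap

theorem completeSpace_graphSpace (T : V →ₗ[ℝ] W) (h : IsComplete {z : V × W | T z.1 = z.2}) :
    CompleteSpace (graphSpace T) := by
  have himage : WithLp.uniformEquivProd 2 V W '' (graphSpace T : Set (WithLp 2 (V × W)))
      = {z : V × W | T z.1 = z.2} := by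
    ext z
    constructor
    · rintro ⟨y, hy, rfl⟩
      exact Eq.symm hy
    · intro hz
      exact ⟨WithLp.toLp 2 z, Eq.symm hz, rfl⟩
  refine IsComplete.completeSpace_coe
    (s := (graphSpace T : Set (WithLp 2 (V × W)))) ?_
  rw [← (WithLp.uniformEquivProd 2 V W).isUniformInducing.isComplete_iff, himage]
  exact h

/-- The coordinate in the domain, as a bounded map on the graph space. -/
def graphFst (T : V →ₗ[ℝ] W) : graphSpace T →L[ℝ] V :=
  (WithLp.fstL 2 ℝ V W).comp (graphSpace T).subtypeL

/-- The linear map itself, as a bounded map on its graph space. -/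
def graphSnd (T : V →ₗ[ℝ] W) : graphSpace T →L[ℝ] W :=
  (WithLp.sndL 2 ℝ V W).comp (graphSpace T).subtypeL

theorem graphSnd_apply (T : V →ₗ[ℝ] W) (z : graphSpace T) :
    graphSnd T z = T (graphFst T z) := z.2

theorem norm_sq_graphSpace (T : V →ₗ[ℝ] W) (z : graphSpace T) :
    ‖z‖ ^ 2 = ‖graphFst T z‖ ^ 2 + ‖T (graphFst T z)‖ ^ 2 := by
  rw [← graphSnd_apply]
  exact WithLp.prod_norm_sq_eq_of_L2 _

theorem exists_graphFst_eq (T : V →ₗ[ℝ] W) (v : V) : ∃ z : graphSpace T, graphFst T z = v :=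
  ⟨⟨WithLp.toLp 2 (v, T v), rfl⟩, rfl⟩

end GraphSpace

section Stability

theorem real_inner_le_young {V : Type*} [NormedAddCommGroup V] [InnerProductSpace ℝ V]
    (x y : V) {t : ℝ} (ht : 0 < t) : ⟪x, y⟫ ≤ t * ‖x‖ ^ 2 + ‖y‖ ^ 2 / (4 * t) := by
  refine (real_inner_le_norm x y).trans ?_
  have h : t * ‖x‖ ^ 2 + ‖y‖ ^ 2 / (4 * t) - ‖x‖ * ‖y‖
      = (2 * t * ‖x‖ - ‖y‖) ^ 2 / (4 * t) := by field_simp; ring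
  have : 0 ≤ (2 * t * ‖x‖ - ‖y‖) ^ 2 / (4 * t) := by positivity
  linarith

theorem mul_le_sq_add_of_sq_le {κ F N Z : ℝ} (hκ : 0 < κ) (h : N ^ 2 ≤ κ ^ 2 * Z) :
    F * N ≤ κ ^ 2 * F ^ 2 + Z / 4 := by
  have h1 : 0 ≤ (2 * κ * F - N / κ) ^ 2 := sq_nonneg _
  have h2 : (2 * κ * F - N / κ) ^ 2 = 4 * κ ^ 2 * F ^ 2 - 4 * (F * N) + N ^ 2 / κ ^ 2 := by
    field_simp; ring
  have h3 : N ^ 2 / κ ^ 2 ≤ Z := by rw [div_le_iff₀ (by positivity)]; linarith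
  linarith

theorem le_mul_of_sq_le {κ F N : ℝ} (hκ : 1 ≤ κ) (hF : 0 ≤ F)
    (h : N ^ 2 ≤ κ * (F ^ 2 + F * N)) : N ≤ 2 * κ * F := by
  by_contra! hN
  nlinarith [mul_nonneg (by linarith : (0 : ℝ) ≤ κ) hF,
    mul_nonneg (by linarith : (0 : ℝ) ≤ κ - 1) hF]

variable {μ lam K δ c₀ α : ℝ} {C : R →ₗ[ℝ] U} {D : U →ₗ[ℝ] P} {E : Q →ₗ[ℝ] P}

theorem etaC_pos (hμ : 0 < μ) (hlam : 0 < lam) (hK : 0 < K) (hδ : 0 < δ) (hc : 0 ≤ c₀) :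
    0 < etaC μ lam K δ c₀ α := by
  unfold etaC; positivity

theorem Xnorm_sq (hμ : 0 < μ) (hlam : 0 < lam) (hK : 0 < K) (hδ : 0 < δ) (hc : 0 ≤ c₀)
    (x : R × U × Q × P) :
    Xnorm μ lam K δ c₀ α C D E x ^ 2 = μ⁻¹ * (‖x.1‖ ^ 2 + ‖C x.1‖ ^ 2) + μ * ‖x.2.1‖ ^ 2
      + (2 * μ + lam) * ‖D x.2.1‖ ^ 2 + K⁻¹ * ‖x.2.2.1‖ ^ 2
      + δ ^ 2 / etaC μ lam K δ c₀ α * ‖E x.2.2.1‖ ^ 2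
      + etaC μ lam K δ c₀ α * ‖x.2.2.2‖ ^ 2 := by
  have := etaC_pos (α := α) hμ hlam hK hδ hc
  exact Real.sq_sqrt (by positivity)

theorem Xnorm_nonneg (x : R × U × Q × P) : 0 ≤ Xnorm μ lam K δ c₀ α C D E x :=
  Real.sqrt_nonneg _

theorem Xnorm_neg (x : R × U × Q × P) :
    Xnorm μ lam K δ c₀ α C D E (-x) = Xnorm μ lam K δ c₀ α C D E x := by
  simp [Xnorm]

theorem Xnorm_zero : Xnorm μ lam K δ c₀ α C D E 0 = 0 := by
  simp [Xnorm]

/-- Changing the signs of the rotation and the pressure transposes the Biot form. -/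
theorem biotForm_swap (r r' : R) (u u' : U) (q q' : Q) (p p' : P) :
    biotForm μ lam K δ c₀ α C D E (-r, u, q, -p) (-r', u', q', -p')
      = biotForm μ lam K δ c₀ α C D E (r', u', q', p') (r, u, q, p) := by
  simp only [biotForm, map_neg, inner_neg_left, inner_neg_right, real_inner_comm r r',
    real_inner_comm (D u) (D u'), real_inner_comm q q', real_inner_comm p p']
  ring

variable (μ lam K δ c₀ α C D E)

theorem biotForm_self (x : R × U × Q × P) :
    biotForm μ lam K δ c₀ α C D E x x = μ⁻¹ * ‖x.1‖ ^ 2 + (2 * μ + lam) * ‖D x.2.1‖ ^ 2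
      + K⁻¹ * ‖x.2.2.1‖ ^ 2 + c₀ * ‖x.2.2.2‖ ^ 2 := by
  simp only [biotForm, real_inner_self_eq_norm_sq]
  ring

theorem biotForm_rotation (x : R × U × Q × P) (s : R) :
    biotForm μ lam K δ c₀ α C D E x (s, 0, 0, 0) = μ⁻¹ * ⟪x.1, s⟫ - ⟪C s, x.2.1⟫ := by
  simp [biotForm]

theorem biotForm_displacement (x : R × U × Q × P) (v : U) :
    biotForm μ lam K δ c₀ α C D E x (0, v, 0, 0)
      = (2 * μ + lam) * ⟪D x.2.1, D v⟫ + ⟪C x.1, v⟫ - α * ⟪D v, x.2.2.2⟫ := by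
  simp [biotForm, real_inner_smul_left]

theorem biotForm_flux (x : R × U × Q × P) (v : Q) :
    biotForm μ lam K δ c₀ α C D E x (0, 0, v, 0)
      = K⁻¹ * ⟪x.2.2.1, v⟫ - δ * ⟪E v, x.2.2.2⟫ := by
  simp [biotForm, real_inner_smul_left]

theorem biotForm_pressure (x : R × U × Q × P) (v : P) :
    biotForm μ lam K δ c₀ α C D E x (0, 0, 0, v)
      = c₀ * ⟪x.2.2.2, v⟫ + α * ⟪D x.2.1, v⟫ + δ * ⟪E x.2.2.1, v⟫ := by
  simp [biotForm, inner_add_left, real_inner_smul_left]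
  ring

variable {μ lam K δ c₀ α C D E}

section Components

variable {x : R × U × Q × P} {F κ : ℝ}

theorem curl_rotation_bound
    (hμ : 0 < μ) (hlam : 0 < lam) (hK : 0 < K) (hδ : 0 < δ) (hc : 0 ≤ c₀)
    (hF : ∀ y, biotForm μ lam K δ c₀ α C D E x y ≤ F * Xnorm μ lam K δ c₀ α C D E y)
    (hDC : ∀ r, D (C r) = 0) :
    μ⁻¹ * ‖C x.1‖ ^ 2 ≤ 2 * F ^ 2 := by
  have h := hF (0, μ⁻¹ • C x.1, 0, 0)
  rw [biotForm_displacement] at h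
  have hN := mul_le_sq_add_of_sq_le (κ := 1) (F := F)
    (N := Xnorm μ lam K δ c₀ α C D E (0, μ⁻¹ • C x.1, 0, 0)) (Z := μ⁻¹ * ‖C x.1‖ ^ 2) one_pos (by
      rw [Xnorm_sq hμ hlam hK hδ hc]
      simp only [map_zero, norm_zero, map_smul, hDC, norm_smul, Real.norm_eq_abs, mul_pow, sq_abs]
      apply le_of_eq
      field_simp
      simp)
  simp only [map_smul, hDC, smul_zero, inner_zero_right, inner_zero_left, real_inner_smul_right,
    real_inner_self_eq_norm_sq] at h
  have : 0 ≤ μ⁻¹ * ‖C x.1‖ ^ 2 := by positivity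
  linarith [sq_nonneg F]

theorem displacement_kernel_bound
    (hμ : 0 < μ) (hlam : 0 < lam) (hK : 0 < K) (hδ : 0 < δ) (hc : 0 ≤ c₀)
    (hF : ∀ y, biotForm μ lam K δ c₀ α C D E x y ≤ F * Xnorm μ lam K δ c₀ α C D E y)
    (hκ : 1 ≤ κ) {w : U} (hw : ⟪w, x.2.1⟫ = ‖w‖ ^ 2)
    {s : R} (hs : C s = w) (hsκ : ‖s‖ ^ 2 + ‖C s‖ ^ 2 ≤ κ ^ 2 * ‖w‖ ^ 2) :
    μ * ‖w‖ ^ 2 ≤ 2 * κ ^ 2 * (F ^ 2 + μ⁻¹ * ‖x.1‖ ^ 2) := by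
  have hκ0 : 0 < κ := by linarith
  have h := hF (-(μ • s), 0, 0, 0)
  have hN := mul_le_sq_add_of_sq_le (κ := κ) (F := F)
    (N := Xnorm μ lam K δ c₀ α C D E (-(μ • s), 0, 0, 0)) (Z := μ * ‖w‖ ^ 2) hκ0 (by
      rw [Xnorm_sq hμ hlam hK hδ hc]
      simp only [map_zero, norm_zero, map_neg, map_smul, norm_neg, norm_smul, Real.norm_eq_abs,
        mul_pow, sq_abs]
      calc _ = μ * (‖s‖ ^ 2 + ‖C s‖ ^ 2) := by field_simp; ring
        _ ≤ μ * (κ ^ 2 * ‖w‖ ^ 2) := by gcongr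
        _ = _ := by ring)
  rw [biotForm_rotation, map_neg, map_smul, hs, inner_neg_left, inner_neg_right,
    real_inner_smul_left, real_inner_smul_right, hw, mul_neg, inv_mul_cancel_left₀ hμ.ne'] at h
  have hy := real_inner_le_young x.1 s (t := κ ^ 2 * μ⁻¹) (by positivity)
  have hs2 : ‖s‖ ^ 2 / (4 * (κ ^ 2 * μ⁻¹)) ≤ μ * ‖w‖ ^ 2 / 4 := by
    have : ‖s‖ ^ 2 ≤ κ ^ 2 * ‖w‖ ^ 2 := by linarith [sq_nonneg ‖C s‖]
    calc _ ≤ κ ^ 2 * ‖w‖ ^ 2 / (4 * (κ ^ 2 * μ⁻¹)) := by gcongr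
      _ = _ := by field_simp
  linarith

theorem pressure_elastic_bound
    (hμ : 0 < μ) (hlam : 0 < lam) (hK : 0 < K) (hδ : 0 < δ) (hc : 0 ≤ c₀)
    (hF : ∀ y, biotForm μ lam K δ c₀ α C D E x y ≤ F * Xnorm μ lam K δ c₀ α C D E y)
    (hκ : 1 ≤ κ) {v : U} (hCv : ⟪C x.1, v⟫ = 0) (hDv : D v = x.2.2.2)
    (hvκ : ‖v‖ ^ 2 + ‖D v‖ ^ 2 ≤ κ ^ 2 * ‖x.2.2.2‖ ^ 2) :
    α ^ 2 / (2 * μ + lam) * ‖x.2.2.2‖ ^ 2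
      ≤ 2 * κ ^ 2 * (F ^ 2 + (2 * μ + lam) * ‖D x.2.1‖ ^ 2) := by
  have hκ0 : 0 < κ := by linarith
  have hν : 0 < 2 * μ + lam := by positivity
  have hμν : μ ≤ 2 * μ + lam := by linarith
  have h := hF (0, -((α / (2 * μ + lam)) • v), 0, 0)
  have hN := mul_le_sq_add_of_sq_le (κ := κ) (F := F)
    (N := Xnorm μ lam K δ c₀ α C D E (0, -((α / (2 * μ + lam)) • v), 0, 0))
    (Z := α ^ 2 / (2 * μ + lam) * ‖x.2.2.2‖ ^ 2) hκ0 (by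
      rw [Xnorm_sq hμ hlam hK hδ hc]
      simp only [map_zero, norm_zero, map_neg, map_smul, norm_neg, norm_smul, Real.norm_eq_abs,
        mul_pow, sq_abs]
      calc _ = (α / (2 * μ + lam)) ^ 2 * (μ * ‖v‖ ^ 2 + (2 * μ + lam) * ‖D v‖ ^ 2) := by ring
        _ ≤ (α / (2 * μ + lam)) ^ 2 * ((2 * μ + lam) * ‖v‖ ^ 2 + (2 * μ + lam) * ‖D v‖ ^ 2) := by
          gcongr
        _ = α ^ 2 / (2 * μ + lam) * (‖v‖ ^ 2 + ‖D v‖ ^ 2) := by field_simp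
        _ ≤ α ^ 2 / (2 * μ + lam) * (κ ^ 2 * ‖x.2.2.2‖ ^ 2) := by gcongr
        _ = _ := by ring)
  rw [biotForm_displacement, map_neg, map_smul, hDv, inner_neg_left, inner_neg_right,
    inner_neg_right, real_inner_smul_left, real_inner_smul_right, real_inner_smul_right, hCv,
    real_inner_self_eq_norm_sq] at h
  have hy := real_inner_le_young (D x.2.1) (α • x.2.2.2) hν
  rw [real_inner_smul_right, norm_smul, mul_pow, Real.norm_eq_abs, sq_abs] at hy
  have h1 : (2 * μ + lam) * -(α / (2 * μ + lam) * ⟪D x.2.1, x.2.2.2⟫)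
      = -(α * ⟪D x.2.1, x.2.2.2⟫) := by field_simp
  have h2 : α * -(α / (2 * μ + lam) * ‖x.2.2.2‖ ^ 2)
      = -(α ^ 2 / (2 * μ + lam) * ‖x.2.2.2‖ ^ 2) := by ring
  have h3 : α ^ 2 * ‖x.2.2.2‖ ^ 2 / (4 * (2 * μ + lam))
      = α ^ 2 / (2 * μ + lam) * ‖x.2.2.2‖ ^ 2 / 4 := by field_simp
  have h4 : (2 * μ + lam) * ‖D x.2.1‖ ^ 2 ≤ κ ^ 2 * ((2 * μ + lam) * ‖D x.2.1‖ ^ 2) :=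
    le_mul_of_one_le_left (by positivity) (one_le_pow₀ hκ)
  have h5 : 0 ≤ κ ^ 2 * F ^ 2 := by positivity
  have h6 : 0 ≤ α ^ 2 / (2 * μ + lam) * ‖x.2.2.2‖ ^ 2 := by positivity
  rw [h1, h2] at h
  rw [h3] at hy
  linarith

theorem pressure_flow_bound
    (hμ : 0 < μ) (hlam : 0 < lam) (hK : 0 < K) (hδ : 0 < δ) (hc : 0 ≤ c₀)
    (hF : ∀ y, biotForm μ lam K δ c₀ α C D E x y ≤ F * Xnorm μ lam K δ c₀ α C D E y)
    (hκ : 1 ≤ κ) {v : Q} (hEv : E v = x.2.2.2)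
    (hvκ : ‖v‖ ^ 2 + ‖E v‖ ^ 2 ≤ κ ^ 2 * ‖x.2.2.2‖ ^ 2) :
    δ ^ 2 * K * ‖x.2.2.2‖ ^ 2 ≤ 2 * κ ^ 2 * (F ^ 2 + K⁻¹ * ‖x.2.2.1‖ ^ 2) := by
  have hκ0 : 0 < κ := by linarith
  have hη := etaC_pos (α := α) hμ hlam hK hδ hc
  have hηK : δ ^ 2 * K ≤ etaC μ lam K δ c₀ α := by
    have : 0 ≤ α ^ 2 / (2 * μ + lam) := by positivity
    unfold etaC; linarith
  have h := hF (0, 0, -((δ * K) • v), 0)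
  have hN := mul_le_sq_add_of_sq_le (κ := κ) (F := F)
    (N := Xnorm μ lam K δ c₀ α C D E (0, 0, -((δ * K) • v), 0))
    (Z := δ ^ 2 * K * ‖x.2.2.2‖ ^ 2) hκ0 (by
      rw [Xnorm_sq hμ hlam hK hδ hc]
      simp only [map_zero, norm_zero, map_neg, map_smul, norm_neg, norm_smul, Real.norm_eq_abs,
        mul_pow, sq_abs]
      calc _ = δ ^ 2 * K * ‖v‖ ^ 2
              + δ ^ 2 * K * (δ ^ 2 * K / etaC μ lam K δ c₀ α) * ‖E v‖ ^ 2 := by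
            field_simp; ring
        _ ≤ δ ^ 2 * K * ‖v‖ ^ 2 + δ ^ 2 * K * 1 * ‖E v‖ ^ 2 := by
          gcongr; exact (div_le_one hη).2 hηK
        _ = δ ^ 2 * K * (‖v‖ ^ 2 + ‖E v‖ ^ 2) := by ring
        _ ≤ δ ^ 2 * K * (κ ^ 2 * ‖x.2.2.2‖ ^ 2) := by gcongr
        _ = _ := by ring)
  rw [biotForm_flux, map_neg, map_smul, hEv, inner_neg_left, inner_neg_right,
    real_inner_smul_left, real_inner_smul_right, real_inner_self_eq_norm_sq] at h
  have hy := real_inner_le_young x.2.2.1 (δ • v) (t := κ ^ 2 * K⁻¹) (by positivity)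
  rw [real_inner_smul_right, norm_smul, mul_pow, Real.norm_eq_abs, sq_abs] at hy
  have h1 : K⁻¹ * -(δ * K * ⟪x.2.2.1, v⟫) = -(δ * ⟪x.2.2.1, v⟫) := by field_simp
  have h2 : δ * -(δ * K * ‖x.2.2.2‖ ^ 2) = -(δ ^ 2 * K * ‖x.2.2.2‖ ^ 2) := by ring
  have h3 : δ ^ 2 * ‖v‖ ^ 2 / (4 * (κ ^ 2 * K⁻¹)) ≤ δ ^ 2 * K * ‖x.2.2.2‖ ^ 2 / 4 := by
    have : ‖v‖ ^ 2 ≤ κ ^ 2 * ‖x.2.2.2‖ ^ 2 := by linarith [sq_nonneg ‖E v‖]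
    calc _ ≤ δ ^ 2 * (κ ^ 2 * ‖x.2.2.2‖ ^ 2) / (4 * (κ ^ 2 * K⁻¹)) := by gcongr
      _ = _ := by field_simp
  rw [h1, h2] at h
  linarith

theorem div_flux_bound
    (hμ : 0 < μ) (hlam : 0 < lam) (hK : 0 < K) (hδ : 0 < δ) (hc : 0 ≤ c₀)
    (hF : ∀ y, biotForm μ lam K δ c₀ α C D E x y ≤ F * Xnorm μ lam K δ c₀ α C D E y) :
    δ ^ 2 / etaC μ lam K δ c₀ α * ‖E x.2.2.1‖ ^ 2
      ≤ 4 * (F ^ 2 + (2 * μ + lam) * ‖D x.2.1‖ ^ 2 + c₀ * ‖x.2.2.2‖ ^ 2) := by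
  have hη := etaC_pos (α := α) hμ hlam hK hδ hc
  have hν : 0 < 2 * μ + lam := by positivity
  have hα0 : 0 ≤ α ^ 2 / (2 * μ + lam) := by positivity
  have hK0 : 0 < δ ^ 2 * K := by positivity
  have hηα : α ^ 2 / (2 * μ + lam) ≤ etaC μ lam K δ c₀ α := by unfold etaC; linarith
  have hηc : c₀ ≤ etaC μ lam K δ c₀ α := by unfold etaC; linarith
  generalize hW : etaC μ lam K δ c₀ α = W at *
  set Z := δ ^ 2 / W * ‖E x.2.2.1‖ ^ 2 with hZ
  set v := (δ / W) • E x.2.2.1 with hv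
  have hvZ : W * ‖v‖ ^ 2 = Z := by
    rw [hv, hZ, norm_smul, mul_pow, Real.norm_eq_abs, sq_abs]; field_simp
  have h := hF (0, 0, 0, v)
  have hN := mul_le_sq_add_of_sq_le (κ := 1) (F := F)
    (N := Xnorm μ lam K δ c₀ α C D E (0, 0, 0, v)) (Z := Z) one_pos (by
      rw [Xnorm_sq hμ hlam hK hδ hc, hW]
      simp [hvZ])
  rw [biotForm_pressure] at h
  have h1 : δ * ⟪E x.2.2.1, v⟫ = Z := by
    rw [hv, real_inner_smul_right, real_inner_self_eq_norm_sq]; ring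
  have h2 := real_inner_le_young (-x.2.2.2) v one_pos
  rw [inner_neg_left, norm_neg] at h2
  have h2' := mul_le_mul_of_nonneg_left h2 hc
  have h3 := real_inner_le_young (D x.2.1) ((-α) • v) hν
  rw [real_inner_smul_right, norm_smul, mul_pow, Real.norm_eq_abs, sq_abs, neg_sq] at h3
  have h4 : α ^ 2 * ‖v‖ ^ 2 / (4 * (2 * μ + lam)) ≤ Z / 4 := by
    calc _ = α ^ 2 / (2 * μ + lam) * ‖v‖ ^ 2 / 4 := by field_simp
      _ ≤ W * ‖v‖ ^ 2 / 4 := by gcongr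
      _ = _ := by rw [hvZ]
  have h5 : c₀ * ‖v‖ ^ 2 ≤ Z := by rw [← hvZ]; gcongr
  linarith

end Components

/-- Stability of the Biot form, uniformly in the material parameters. -/
theorem Xnorm_le_of_biotForm_le (hμ : 0 < μ) (hlam : 0 < lam) (hK : 0 < K) (hδ : 0 < δ)
    (hc : 0 ≤ c₀) {κ : ℝ} (hκ : 1 ≤ κ) {Pi : U →ₗ[ℝ] U}
    (hDC : ∀ r, D (C r) = 0) (hDPi : ∀ u, D (Pi u) = 0) (hPiC : ∀ r, Pi (C r) = C r)
    (hPi_idem : ∀ u : U, Pi (Pi u) = Pi u) (hPi_symm : ∀ u v : U, ⟪Pi u, v⟫ = ⟪u, Pi v⟫)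
    (hPoin : ∀ u : U, Pi u = 0 → ‖u‖ ≤ κ * ‖D u‖)
    (hlift_r : ∀ u : U, ∃ r : R, C r = Pi u ∧ ‖r‖ ^ 2 + ‖C r‖ ^ 2 ≤ κ ^ 2 * ‖Pi u‖ ^ 2)
    (hlift_u : ∀ p : P, ∃ u : U, D u = p ∧ Pi u = 0 ∧ ‖u‖ ^ 2 + ‖D u‖ ^ 2 ≤ κ ^ 2 * ‖p‖ ^ 2)
    (hlift_q : ∀ p : P, ∃ q : Q, E q = p ∧ ‖q‖ ^ 2 + ‖E q‖ ^ 2 ≤ κ ^ 2 * ‖p‖ ^ 2)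
    {x : R × U × Q × P} {F : ℝ} (hF0 : 0 ≤ F)
    (hF : ∀ y, biotForm μ lam K δ c₀ α C D E x y ≤ F * Xnorm μ lam K δ c₀ α C D E y) :
    Xnorm μ lam K δ c₀ α C D E x ≤ 40 * κ ^ 2 * F := by
  have hκ2 : 1 ≤ κ ^ 2 := one_le_pow₀ hκ
  have hself := hF x
  rw [biotForm_self] at hself
  have hCr := curl_rotation_bound hμ hlam hK hδ hc hF hDC
  have hPiu : μ * ‖Pi x.2.1‖ ^ 2 ≤ 2 * κ ^ 2 * (F ^ 2 + μ⁻¹ * ‖x.1‖ ^ 2) := by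
    obtain ⟨s, hs, hsκ⟩ := hlift_r x.2.1
    refine displacement_kernel_bound hμ hlam hK hδ hc hF hκ ?_ hs hsκ
    rw [← real_inner_self_eq_norm_sq, ← hPi_symm, hPi_idem]
  have hu : μ * ‖x.2.1‖ ^ 2
      ≤ 2 * (μ * ‖Pi x.2.1‖ ^ 2) + κ ^ 2 * ((2 * μ + lam) * ‖D x.2.1‖ ^ 2) := by
    have hp := hPoin (x.2.1 - Pi x.2.1) (by rw [map_sub, hPi_idem, sub_self])
    rw [map_sub, hDPi, sub_zero] at hp
    have hp2 : ‖x.2.1 - Pi x.2.1‖ ^ 2 ≤ κ ^ 2 * ‖D x.2.1‖ ^ 2 := by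
      rw [← mul_pow]; gcongr
    have htri : ‖x.2.1‖ ^ 2 ≤ 2 * ‖Pi x.2.1‖ ^ 2 + 2 * ‖x.2.1 - Pi x.2.1‖ ^ 2 := by
      have : ‖x.2.1‖ ≤ ‖Pi x.2.1‖ + ‖x.2.1 - Pi x.2.1‖ := by
        simpa using norm_add_le (Pi x.2.1) (x.2.1 - Pi x.2.1)
      calc _ ≤ (‖Pi x.2.1‖ + ‖x.2.1 - Pi x.2.1‖) ^ 2 := by gcongr
        _ ≤ _ := by linarith [sq_nonneg (‖Pi x.2.1‖ - ‖x.2.1 - Pi x.2.1‖)]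
    calc _ ≤ μ * (2 * ‖Pi x.2.1‖ ^ 2 + 2 * (κ ^ 2 * ‖D x.2.1‖ ^ 2)) := by gcongr; linarith
      _ = 2 * (μ * ‖Pi x.2.1‖ ^ 2) + κ ^ 2 * ((2 * μ) * ‖D x.2.1‖ ^ 2) := by ring
      _ ≤ _ := by gcongr; linarith
  have hpα : α ^ 2 / (2 * μ + lam) * ‖x.2.2.2‖ ^ 2
      ≤ 2 * κ ^ 2 * (F ^ 2 + (2 * μ + lam) * ‖D x.2.1‖ ^ 2) := by
    obtain ⟨v, hDv, hPiv, hvκ⟩ := hlift_u x.2.2.2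
    refine pressure_elastic_bound hμ hlam hK hδ hc hF hκ ?_ hDv hvκ
    rw [← hPiC, hPi_symm, hPiv, inner_zero_right]
  have hpK : δ ^ 2 * K * ‖x.2.2.2‖ ^ 2 ≤ 2 * κ ^ 2 * (F ^ 2 + K⁻¹ * ‖x.2.2.1‖ ^ 2) := by
    obtain ⟨v, hEv, hvκ⟩ := hlift_q x.2.2.2
    exact pressure_flow_bound hμ hlam hK hδ hc hF hκ hEv hvκ
  have hEq := div_flux_bound hμ hlam hK hδ hc hF
  have hη : etaC μ lam K δ c₀ α * ‖x.2.2.2‖ ^ 2 = α ^ 2 / (2 * μ + lam) * ‖x.2.2.2‖ ^ 2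
      + δ ^ 2 * K * ‖x.2.2.2‖ ^ 2 + c₀ * ‖x.2.2.2‖ ^ 2 := by unfold etaC; ring
  have hN := Xnorm_sq (α := α) (C := C) (D := D) (E := E) hμ hlam hK hδ hc x
  have hr0 : 0 ≤ μ⁻¹ * ‖x.1‖ ^ 2 := by positivity
  have hDu0 : 0 ≤ (2 * μ + lam) * ‖D x.2.1‖ ^ 2 := by positivity
  have hq0 : 0 ≤ K⁻¹ * ‖x.2.2.1‖ ^ 2 := by positivity
  have hp0 : 0 ≤ c₀ * ‖x.2.2.2‖ ^ 2 := by positivity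
  have hscale : ∀ {t : ℝ}, 0 ≤ t → t ≤ κ ^ 2 * t := fun ht => le_mul_of_one_le_left ht hκ2
  have hmain : Xnorm μ lam K δ c₀ α C D E x ^ 2
      ≤ 20 * κ ^ 2 * (F ^ 2 + F * Xnorm μ lam K δ c₀ α C D E x) := by
    have := mul_le_mul_of_nonneg_left hself (sq_nonneg κ)
    linarith [hscale hr0, hscale hDu0, hscale hq0, hscale hp0, hscale (sq_nonneg F),
      mul_nonneg (sq_nonneg κ) hr0, mul_nonneg (sq_nonneg κ) hDu0,
      mul_nonneg (sq_nonneg κ) hq0, mul_nonneg (sq_nonneg κ) hp0,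
      mul_nonneg (sq_nonneg κ) (sq_nonneg F)]
  calc _ ≤ 2 * (20 * κ ^ 2) * F := le_mul_of_sq_le (by linarith) hF0 hmain
    _ = _ := by ring

end Stability

/-- The bounded bilinear form `⟪S x, T y⟫`. -/
def innerPair {H V : Type*} [NormedAddCommGroup H] [InnerProductSpace ℝ H]
    [NormedAddCommGroup V] [InnerProductSpace ℝ V] (S T : H →L[ℝ] V) : H →L[ℝ] H →L[ℝ] ℝ :=
  (innerSL ℝ).bilinearComp S T

/-- The Biot form is bounded on any space on which the fields and their derivatives are. -/
theorem exists_bilin_eq_biotForm_of_fields {H : Type*} [NormedAddCommGroup H]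
    [InnerProductSpace ℝ H] (μ lam K δ c₀ α : ℝ) {C : R →ₗ[ℝ] U} {D : U →ₗ[ℝ] P} {E : Q →ₗ[ℝ] P}
    {r : H →L[ℝ] R} {Cr : H →L[ℝ] U} {u : H →L[ℝ] U} {Du : H →L[ℝ] P}
    {q : H →L[ℝ] Q} {Eq : H →L[ℝ] P} (p : H →L[ℝ] P)
    (hCr : ∀ z, Cr z = C (r z)) (hDu : ∀ z, Du z = D (u z)) (hEq : ∀ z, Eq z = E (q z)) :
    ∃ B : H →L[ℝ] H →L[ℝ] ℝ, ∀ x y,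
      B x y = biotForm μ lam K δ c₀ α C D E (r x, u x, q x, p x) (r y, u y, q y, p y) := by
  refine ⟨μ⁻¹ • innerPair r r + (2 * μ + lam) • innerPair Du Du + K⁻¹ • innerPair q q
    + c₀ • innerPair p p + innerPair Cr u + innerPair (α • Du + δ • Eq) p
    - innerPair u Cr - innerPair p (α • Du + δ • Eq), fun x y => ?_⟩
  simp only [biotForm, innerPair, add_apply, sub_apply, smul_apply, smul_eq_mul,
    ContinuousLinearMap.bilinearComp_apply, innerSL_apply_apply, hCr, hDu, hEq]
  rw [real_inner_comm (u x), real_inner_comm (p x)]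

section EnergySpace

/-- The space `X` with the unweighted Hilbert norm built from the graph norms. -/
abbrev EnergySpace (C : R →ₗ[ℝ] U) (D : U →ₗ[ℝ] P) (E : Q →ₗ[ℝ] P) : Type _ :=
  WithLp 2 (graphSpace C × WithLp 2 (graphSpace D × WithLp 2 (graphSpace E × P)))

variable (C : R →ₗ[ℝ] U) (D : U →ₗ[ℝ] P) (E : Q →ₗ[ℝ] P)

namespace EnergySpace

/-- The rotation, as an element of its graph space. -/
def rotation : EnergySpace C D E →L[ℝ] graphSpace C := WithLp.fstL 2 ℝ _ _

/-- The displacement, as an element of its graph space. -/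
def displacement : EnergySpace C D E →L[ℝ] graphSpace D :=
  (WithLp.fstL 2 ℝ _ _).comp (WithLp.sndL 2 ℝ _ _)

/-- The flux, as an element of its graph space. -/
def flux : EnergySpace C D E →L[ℝ] graphSpace E :=
  (WithLp.fstL 2 ℝ _ _).comp ((WithLp.sndL 2 ℝ _ _).comp (WithLp.sndL 2 ℝ _ _))

/-- The pressure. -/
def pressure : EnergySpace C D E →L[ℝ] P :=
  (WithLp.sndL 2 ℝ _ _).comp ((WithLp.sndL 2 ℝ _ _).comp (WithLp.sndL 2 ℝ _ _))

/-- The underlying quadruple of fields. -/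
def toProd : EnergySpace C D E →ₗ[ℝ] R × U × Q × P :=
  ((graphFst C).comp (rotation C D E)).toLinearMap.prod
    (((graphFst D).comp (displacement C D E)).toLinearMap.prod
      (((graphFst E).comp (flux C D E)).toLinearMap.prod (pressure C D E).toLinearMap))

theorem toProd_surjective : Function.Surjective (toProd C D E) := by
  rintro ⟨r, u, q, p⟩
  obtain ⟨zr, rfl⟩ := exists_graphFst_eq C r
  obtain ⟨zu, rfl⟩ := exists_graphFst_eq D u
  obtain ⟨zq, rfl⟩ := exists_graphFst_eq E q
  exact ⟨WithLp.toLp 2 (zr, WithLp.toLp 2 (zu, WithLp.toLp 2 (zq, p))), rfl⟩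

theorem norm_sq (h : EnergySpace C D E) :
    ‖h‖ ^ 2 = ‖(toProd C D E h).1‖ ^ 2 + ‖C (toProd C D E h).1‖ ^ 2
      + (‖(toProd C D E h).2.1‖ ^ 2 + ‖D (toProd C D E h).2.1‖ ^ 2
      + (‖(toProd C D E h).2.2.1‖ ^ 2 + ‖E (toProd C D E h).2.2.1‖ ^ 2
      + ‖(toProd C D E h).2.2.2‖ ^ 2)) := by
  rw [WithLp.prod_norm_sq_eq_of_L2, WithLp.prod_norm_sq_eq_of_L2, WithLp.prod_norm_sq_eq_of_L2,
    norm_sq_graphSpace, norm_sq_graphSpace, norm_sq_graphSpace]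
  rfl

variable {μ lam K δ c₀ α : ℝ}

theorem exists_norm_le_Xnorm (hμ : 0 < μ) (hlam : 0 < lam) (hK : 0 < K) (hδ : 0 < δ)
    (hc : 0 ≤ c₀) : ∃ M : ℝ, 0 ≤ M ∧ ∀ h : EnergySpace C D E,
      ‖h‖ ≤ M * Xnorm μ lam K δ c₀ α C D E (toProd C D E h) := by
  have hη := etaC_pos (α := α) hμ hlam hK hδ hc
  set W := etaC μ lam K δ c₀ α
  set S := μ + μ⁻¹ + (2 * μ + lam)⁻¹ + K + W / δ ^ 2 + W⁻¹
  have hS0 : 0 ≤ S := by positivity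
  have hweight : ∀ {w a : ℝ}, 0 < w → w⁻¹ ≤ S → 0 ≤ a → a ≤ S * (w * a) := fun {w a} hw hwS ha =>
    calc a = w⁻¹ * (w * a) := by field_simp
      _ ≤ S * (w * a) := by gcongr
  have p1 : 0 < μ⁻¹ := by positivity
  have p2 : 0 < (2 * μ + lam)⁻¹ := by positivity
  have p3 : 0 < W / δ ^ 2 := by positivity
  have p4 : 0 < W⁻¹ := by positivity
  refine ⟨√S, Real.sqrt_nonneg _, fun h => ?_⟩
  refine le_of_sq_le_sq ?_ (mul_nonneg (Real.sqrt_nonneg _) (Xnorm_nonneg _))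
  rw [mul_pow, Real.sq_sqrt hS0, Xnorm_sq hμ hlam hK hδ hc, norm_sq]
  generalize toProd C D E h = x
  have h1 := hweight (w := μ⁻¹) p1 (by rw [inv_inv]; linarith) (sq_nonneg ‖x.1‖)
  have h2 := hweight (w := μ⁻¹) p1 (by rw [inv_inv]; linarith) (sq_nonneg ‖C x.1‖)
  have h3 := hweight (w := μ) hμ (by linarith) (sq_nonneg ‖x.2.1‖)
  have h4 := hweight (w := 2 * μ + lam) (by positivity) (by linarith) (sq_nonneg ‖D x.2.1‖)
  have h5 := hweight (w := K⁻¹) (by positivity) (by rw [inv_inv]; linarith)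
    (sq_nonneg ‖x.2.2.1‖)
  have h6 := hweight (w := δ ^ 2 / W) (by positivity) (by rw [inv_div]; linarith)
    (sq_nonneg ‖E x.2.2.1‖)
  have h7 := hweight (w := W) hη (by linarith) (sq_nonneg ‖x.2.2.2‖)
  linarith

theorem exists_Xnorm_le_norm (hμ : 0 < μ) (hlam : 0 < lam) (hK : 0 < K) (hδ : 0 < δ)
    (hc : 0 ≤ c₀) : ∃ M : ℝ, 0 ≤ M ∧ ∀ h : EnergySpace C D E,
      Xnorm μ lam K δ c₀ α C D E (toProd C D E h) ≤ M * ‖h‖ := by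
  have hη := etaC_pos (α := α) hμ hlam hK hδ hc
  set W := etaC μ lam K δ c₀ α
  set S := μ⁻¹ + μ + (2 * μ + lam) + K⁻¹ + δ ^ 2 / W + W
  have hS0 : 0 ≤ S := by positivity
  have p1 : 0 < μ⁻¹ := by positivity
  have p2 : 0 < K⁻¹ := by positivity
  have p3 : 0 < δ ^ 2 / W := by positivity
  refine ⟨√S, Real.sqrt_nonneg _, fun h => ?_⟩
  refine le_of_sq_le_sq ?_ (by positivity)
  rw [mul_pow, Real.sq_sqrt hS0, Xnorm_sq hμ hlam hK hδ hc, norm_sq]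
  generalize toProd C D E h = x
  have h1 : μ⁻¹ * (‖x.1‖ ^ 2 + ‖C x.1‖ ^ 2) ≤ S * (‖x.1‖ ^ 2 + ‖C x.1‖ ^ 2) := by
    gcongr; linarith
  have h2 : μ * ‖x.2.1‖ ^ 2 ≤ S * ‖x.2.1‖ ^ 2 := by gcongr; linarith
  have h3 : (2 * μ + lam) * ‖D x.2.1‖ ^ 2 ≤ S * ‖D x.2.1‖ ^ 2 := by gcongr; linarith
  have h4 : K⁻¹ * ‖x.2.2.1‖ ^ 2 ≤ S * ‖x.2.2.1‖ ^ 2 := by gcongr; linarith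
  have h5 : δ ^ 2 / W * ‖E x.2.2.1‖ ^ 2 ≤ S * ‖E x.2.2.1‖ ^ 2 := by gcongr; linarith
  have h6 : W * ‖x.2.2.2‖ ^ 2 ≤ S * ‖x.2.2.2‖ ^ 2 := by gcongr; linarith
  linarith

variable (μ lam K δ c₀ α) in
theorem exists_bilin_eq_biotForm : ∃ B : EnergySpace C D E →L[ℝ] EnergySpace C D E →L[ℝ] ℝ,
    ∀ x y, B x y = biotForm μ lam K δ c₀ α C D E (toProd C D E x) (toProd C D E y) :=
  exists_bilin_eq_biotForm_of_fields μ lam K δ c₀ α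
    (r := (graphFst C).comp (rotation C D E)) (Cr := (graphSnd C).comp (rotation C D E))
    (u := (graphFst D).comp (displacement C D E)) (Du := (graphSnd D).comp (displacement C D E))
    (q := (graphFst E).comp (flux C D E)) (Eq := (graphSnd E).comp (flux C D E))
    (pressure C D E)
    (fun z => graphSnd_apply C (rotation C D E z))
    (fun z => graphSnd_apply D (displacement C D E z))
    (fun z => graphSnd_apply E (flux C D E z))

end EnergySpace

end EnergySpace

theorem exists_common_bound {αu βr βu βq : ℝ} (hαu : 0 < αu) (hβr : 0 < βr) (hβu : 0 < βu)
    (hβq : 0 < βq) : ∃ κ : ℝ, 1 ≤ κ ∧ (∀ a b : ℝ, 0 ≤ b → αu * a ≤ b → a ≤ κ * b) ∧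
      ∀ β ∈ ({βr, βu, βq} : Set ℝ), ∀ a b : ℝ, 0 ≤ b → β * a ≤ b → a ≤ κ ^ 2 * b := by
  have ha : 0 < αu⁻¹ := by positivity
  have hr : 0 < βr⁻¹ := by positivity
  have hu : 0 < βu⁻¹ := by positivity
  have hq : 0 < βq⁻¹ := by positivity
  have hscale : ∀ {β κ a b : ℝ}, 0 < β → β⁻¹ ≤ κ → 0 ≤ b → β * a ≤ b → a ≤ κ * b :=
    fun {β κ a b} hβ hκ hb hab =>
    calc a = β⁻¹ * (β * a) := by field_simp
      _ ≤ β⁻¹ * b := by gcongr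
      _ ≤ κ * b := by gcongr
  set κ := 1 + αu⁻¹ + βr⁻¹ + βu⁻¹ + βq⁻¹
  have hκ1 : 1 ≤ κ := by linarith
  have hκ2 : κ ≤ κ ^ 2 := by nlinarith
  refine ⟨κ, hκ1, fun a b => hscale hαu (by linarith), ?_⟩
  rintro β (rfl | rfl | rfl) a b
  · exact hscale hβr (by linarith)
  · exact hscale hβu (by linarith)
  · exact hscale hβq (by linarith)

/-- Well-posedness, Theorem 3.4: for every bounded linear functional `f` on
`X` there is a unique `x ∈ X` with `𝒜(x, xt) = f(xt)` for all `xt ∈ X`, and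
`‖x‖_X ≤ C₀ · sup_{xt ≠ 0} f(xt)/‖xt‖_X` with `C₀` independent of `μ, λ, K, δ, c₀, α`. -/
theorem biot_wellposed
    (C : R →ₗ[ℝ] U) (D : U →ₗ[ℝ] P) (E : Q →ₗ[ℝ] P)
    (hrange : LinearMap.range C = LinearMap.ker D)
    (Pi : U →ₗ[ℝ] U)
    (hPi_idem : ∀ u : U, Pi (Pi u) = Pi u)
    (hPi_symm : ∀ u v : U, ⟪Pi u, v⟫ = ⟪u, Pi v⟫)
    (hPi_range : LinearMap.range Pi = LinearMap.range C)
    (αu : ℝ) (hαu : 0 < αu)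
    (hPoin : ∀ u : U, Pi u = 0 → αu * ‖u‖ ≤ ‖D u‖)
    (βr βu βq : ℝ) (hβr : 0 < βr) (hβu : 0 < βu) (hβq : 0 < βq)
    (hlift_r : ∀ u : U, ∃ r : R, C r = Pi u ∧ βr * (‖r‖ ^ 2 + ‖C r‖ ^ 2) ≤ ‖Pi u‖ ^ 2)
    (hlift_u : ∀ p : P, ∃ u : U, D u = p ∧ Pi u = 0 ∧ βu * (‖u‖ ^ 2 + ‖D u‖ ^ 2) ≤ ‖p‖ ^ 2)
    (hlift_q : ∀ p : P, ∃ q : Q, E q = p ∧ βq * (‖q‖ ^ 2 + ‖E q‖ ^ 2) ≤ ‖p‖ ^ 2)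
    (hcomplR : IsComplete {z : R × U | C z.1 = z.2})
    (hcomplU : IsComplete {z : U × P | D z.1 = z.2})
    (hcomplQ : IsComplete {z : Q × P | E z.1 = z.2})
    [CompleteSpace P]
    :
    ∃ C₀ > (0 : ℝ),
      ∀ μ lam K δ c₀ α : ℝ, 0 < μ → 0 < lam → 0 < K → 0 < δ → 0 ≤ c₀ →
        ∀ f : (R × U × Q × P) →ₗ[ℝ] ℝ,
          (∃ Cf : ℝ, ∀ x : R × U × Q × P, |f x| ≤ Cf * Xnorm μ lam K δ c₀ α C D E x) →
          ∃ x : R × U × Q × P,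
            (∀ xt : R × U × Q × P, biotForm μ lam K δ c₀ α C D E x xt = f xt) ∧
            (Xnorm μ lam K δ c₀ α C D E x ≤
              C₀ * ⨆ xt : {y : R × U × Q × P // y ≠ 0},
                f ↑xt / Xnorm μ lam K δ c₀ α C D E ↑xt) ∧
            ∀ x' : R × U × Q × P,
              (∀ xt : R × U × Q × P, biotForm μ lam K δ c₀ α C D E x' xt = f xt) → x' = x := by
  have hDC : ∀ r, D (C r) = 0 := fun r => by
    rw [← LinearMap.mem_ker, ← hrange]; exact ⟨r, rfl⟩
  have hDPi : ∀ u, D (Pi u) = 0 := fun u => by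
    rw [← LinearMap.mem_ker, ← hrange, ← hPi_range]; exact ⟨u, rfl⟩
  have hPiC : ∀ r, Pi (C r) = C r := fun r => by
    obtain ⟨v, hv⟩ : C r ∈ LinearMap.range Pi := hPi_range ▸ ⟨r, rfl⟩
    rw [← hv, hPi_idem]
  obtain ⟨κ, hκ, hκα, hκβ⟩ := exists_common_bound hαu hβr hβu hβq
  refine ⟨40 * κ ^ 2, by positivity, ?_⟩
  intro μ lam K δ c₀ α hμ hlam hK hδ hc f hf
  have hstable : ∀ {x : R × U × Q × P} {F : ℝ}, 0 ≤ F →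
      (∀ y, biotForm μ lam K δ c₀ α C D E x y ≤ F * Xnorm μ lam K δ c₀ α C D E y) →
      Xnorm μ lam K δ c₀ α C D E x ≤ 40 * κ ^ 2 * F := by
    refine Xnorm_le_of_biotForm_le hμ hlam hK hδ hc hκ hDC hDPi hPiC hPi_idem hPi_symm
      (fun u hu => hκα _ _ (norm_nonneg _) (hPoin u hu)) (fun u => ?_) (fun p => ?_) (fun p => ?_)
    · obtain ⟨r, hr, hb⟩ := hlift_r u
      exact ⟨r, hr, hκβ βr (by simp) _ _ (sq_nonneg _) hb⟩
    · obtain ⟨u, hu, hPu, hb⟩ := hlift_u p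
      exact ⟨u, hu, hPu, hκβ βu (by simp) _ _ (sq_nonneg _) hb⟩
    · obtain ⟨q, hq, hb⟩ := hlift_q p
      exact ⟨q, hq, hκβ βq (by simp) _ _ (sq_nonneg _) hb⟩
  obtain ⟨M, hM0, hM⟩ :=
    EnergySpace.exists_norm_le_Xnorm (α := α) C D E hμ hlam hK hδ hc
  obtain ⟨M', hM'0, hM'⟩ :=
    EnergySpace.exists_Xnorm_le_norm (α := α) C D E hμ hlam hK hδ hc
  have hdef : ∀ x, Xnorm μ lam K δ c₀ α C D E x ≤ 0 → x = 0 := fun x hx => by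
    obtain ⟨h, rfl⟩ := EnergySpace.toProd_surjective C D E x
    have : h = 0 := norm_le_zero_iff.1 ((hM h).trans (mul_nonpos_of_nonneg_of_nonpos hM0 hx))
    rw [this, map_zero]
  have := completeSpace_graphSpace C hcomplR
  have := completeSpace_graphSpace D hcomplU
  have := completeSpace_graphSpace E hcomplQ
  obtain ⟨B, hB⟩ := EnergySpace.exists_bilin_eq_biotForm C D E μ lam K δ c₀ α
  obtain ⟨Cf, hCf⟩ := hf
  have hinj : ∀ x, (∀ y, biotForm μ lam K δ c₀ α C D E x y = 0) → x = 0 := fun x hx =>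
    hdef x (by simpa using hstable (x := x) le_rfl fun y => by rw [hx, zero_mul])
  have hexists : ∃ x, ∀ y, biotForm μ lam K δ c₀ α C D E x y = f y := by
    obtain ⟨h, hh⟩ := exists_eq_of_boundedBelow_of_nondegenerate B (M * (40 * κ ^ 2 * M))
      (fun v => by
        have hb := hstable (x := EnergySpace.toProd C D E v) (F := ‖B v‖ * M) (by positivity)
          fun y => by
            obtain ⟨w, rfl⟩ := EnergySpace.toProd_surjective C D E y
            rw [← hB, mul_assoc]
            exact (le_abs_self _).trans <| (B v).le_opNorm w |>.trans <| by gcongr; exact hM w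
        calc ‖v‖ ≤ M * Xnorm μ lam K δ c₀ α C D E (EnergySpace.toProd C D E v) := hM v
          _ ≤ M * (40 * κ ^ 2 * (‖B v‖ * M)) := by gcongr
          _ = _ := by ring)
      (fun w hw => by
        obtain ⟨⟨r, u, q, p⟩, hx⟩ : ∃ x, EnergySpace.toProd C D E w = x := ⟨_, rfl⟩
        have hz := hinj (-r, u, q, -p) fun ⟨r', u', q', p'⟩ => by
          obtain ⟨v, hv⟩ := EnergySpace.toProd_surjective C D E (-r', u', q', -p')
          rw [← neg_neg r', ← neg_neg p', biotForm_swap, ← hv, ← hx, ← hB, hw]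
        have hx0 : EnergySpace.toProd C D E w = 0 := by
          rw [hx]; simpa using hz
        have := hM w
        rw [hx0, Xnorm_zero, mul_zero] at this
        exact norm_le_zero_iff.1 this)
      ((f.comp (EnergySpace.toProd C D E)).mkContinuous (|Cf| * M') fun v => by
        calc |f (EnergySpace.toProd C D E v)|
            ≤ Cf * Xnorm μ lam K δ c₀ α C D E (EnergySpace.toProd C D E v) := hCf _
          _ ≤ |Cf| * (M' * ‖v‖) := by
            gcongr
            · exact Xnorm_nonneg _
            · exact le_abs_self _
            · exact hM' v
          _ = _ := by ring)
    refine ⟨EnergySpace.toProd C D E h, fun y => ?_⟩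
    obtain ⟨w, rfl⟩ := EnergySpace.toProd_surjective C D E y
    rw [← hB, hh]
    rfl
  obtain ⟨x, hx⟩ := hexists
  refine ⟨x, hx, ?_, fun x' hx' => ?_⟩
  · set S := ⨆ xt : {y : R × U × Q × P // y ≠ 0},
      f ↑xt / Xnorm μ lam K δ c₀ α C D E ↑xt
    have hpos : ∀ y, y ≠ 0 → 0 < Xnorm μ lam K δ c₀ α C D E y := fun y hy =>
      lt_of_not_ge fun h => hy (hdef y h)
    have hbdd : BddAbove (Set.range fun xt : {y : R × U × Q × P // y ≠ 0} =>
        f ↑xt / Xnorm μ lam K δ c₀ α C D E ↑xt) := by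
      refine ⟨Cf, ?_⟩
      rintro _ ⟨y, rfl⟩
      exact (div_le_iff₀ (hpos y y.2)).2 ((le_abs_self _).trans (hCf y))
    have hle : ∀ y, y ≠ 0 → f y / Xnorm μ lam K δ c₀ α C D E y ≤ S := fun y hy =>
      le_ciSup hbdd ⟨y, hy⟩
    have hS0 : 0 ≤ S := by
      rcases isEmpty_or_nonempty {y : R × U × Q × P // y ≠ 0} with _ | ⟨⟨y, hy⟩⟩
      · exact (Real.iSup_of_isEmpty _).ge
      · have h1 := hle y hy
        have h2 := hle (-y) (neg_ne_zero.2 hy)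
        rw [map_neg, Xnorm_neg, neg_div] at h2
        linarith
    refine hstable hS0 fun y => ?_
    rw [hx]
    rcases eq_or_ne y 0 with rfl | hy
    · rw [map_zero, Xnorm_zero, mul_zero]
    · exact (div_le_iff₀ (hpos y hy)).1 (hle y hy)
  · refine sub_eq_zero.1 (hinj (x' - x) fun y => ?_)
    have h : biotForm μ lam K δ c₀ α C D E (x' - x) y
        = biotForm μ lam K δ c₀ α C D E x' y - biotForm μ lam K δ c₀ α C D E x y := by
      simp only [biotForm, Prod.fst_sub, Prod.snd_sub, map_sub, inner_sub_left, inner_sub_right,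
        inner_add_left, real_inner_smul_left]
      ring
    rw [h, hx, hx', sub_self]
end
end

section
/- (Invariance of the curl, Lemma 5.4) In the abstract four-field Biot setting with the discrete and quadrature settings, let f be a linear functional on X, let x_h = (r_h, u_h, q_h, p_h) ∈ X_h satisfy 𝒜(x_h, x̃) = f(x̃) for all x̃ ∈ X_h, and let x̂_h = (r̂_h, û_h, q̂_h, p̂_h) ∈ X_h satisfy 𝒜_h(x̂_h, x̃) = f(x̃) for all x̃ ∈ X_h. Then C r̂_h = C r_h. -/
open RealInnerProductSpace

noncomputable section

variable {R U Q P : Type*}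
  [NormedAddCommGroup R] [InnerProductSpace ℝ R]
  [NormedAddCommGroup U] [InnerProductSpace ℝ U]
  [NormedAddCommGroup Q] [InnerProductSpace ℝ Q]
  [NormedAddCommGroup P] [InnerProductSpace ℝ P]

/-- Membership in the discrete product space `X_h := R_h × U_h × Q_h × P_h`. -/
def memXh (Rh : Submodule ℝ R) (Uh : Submodule ℝ U) (Qh : Submodule ℝ Q) (Ph : Submodule ℝ P)
    (x : R × U × Q × P) : Prop :=
  x.1 ∈ Rh ∧ x.2.1 ∈ Uh ∧ x.2.2.1 ∈ Qh ∧ x.2.2.2 ∈ Ph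

/-- The quadrature-perturbed Biot bilinear form `𝒜_h`: the inner products on the rotation
and flux spaces are replaced by the quadrature forms `bR` and `bQ`. -/
def biotFormH (μ lam K δ c₀ α : ℝ) (C : R →ₗ[ℝ] U) (D : U →ₗ[ℝ] P) (E : Q →ₗ[ℝ] P)
    (bR : R →ₗ[ℝ] R →ₗ[ℝ] ℝ) (bQ : Q →ₗ[ℝ] Q →ₗ[ℝ] ℝ) (x y : R × U × Q × P) : ℝ :=
  μ⁻¹ * bR x.1 y.1 + (2 * μ + lam) * ⟪D x.2.1, D y.2.1⟫
    + K⁻¹ * bQ x.2.2.1 y.2.2.1 + c₀ * ⟪x.2.2.2, y.2.2.2⟫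
    + ⟪C x.1, y.2.1⟫ + ⟪α • D x.2.1 + δ • E x.2.2.1, y.2.2.2⟫
    - ⟪C y.1, x.2.1⟫ - ⟪α • D y.2.1 + δ • E y.2.2.1, x.2.2.2⟫

/-- Invariance of the curl, Lemma 5.4: if `x_h` solves the discrete problem
and `x̂_h` the quadrature-perturbed one, then `C r̂_h = C r_h`. -/
theorem curl_invariance
    (C : R →ₗ[ℝ] U) (D : U →ₗ[ℝ] P) (E : Q →ₗ[ℝ] P)
    (hrange : LinearMap.range C = LinearMap.ker D)
    (Rh : Submodule ℝ R) (Uh : Submodule ℝ U) (Qh : Submodule ℝ Q) (Ph : Submodule ℝ P)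
    (hCRh : Rh.map C = LinearMap.ker D ⊓ Uh)
    (hDUh : Uh.map D = Ph)
    (hEQh : Qh.map E = Ph)
    (bR : R →ₗ[ℝ] R →ₗ[ℝ] ℝ) (bQ : Q →ₗ[ℝ] Q →ₗ[ℝ] ℝ)
    (hbR_symm : ∀ a b : R, bR a b = bR b a) (hbR_psd : ∀ a : R, 0 ≤ bR a a)
    (hbQ_symm : ∀ a b : Q, bQ a b = bQ b a) (hbQ_psd : ∀ a : Q, 0 ≤ bQ a a)
    (μ lam K δ c₀ α : ℝ) (hμ : 0 < μ) (hlam : 0 < lam) (hK : 0 < K) (hδ : 0 < δ)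
    (hc₀ : 0 ≤ c₀)
    (f : (R × U × Q × P) →ₗ[ℝ] ℝ)
    (xh xhh : R × U × Q × P)
    (hxh : memXh Rh Uh Qh Ph xh)
    (hsol : ∀ xt : R × U × Q × P, memXh Rh Uh Qh Ph xt →
      biotForm μ lam K δ c₀ α C D E xh xt = f xt)
    (hxhh : memXh Rh Uh Qh Ph xhh)
    (hsolh : ∀ xt : R × U × Q × P, memXh Rh Uh Qh Ph xt →
      biotFormH μ lam K δ c₀ α C D E bR bQ xhh xt = f xt)
    :
    C xhh.1 = C xh.1 := by
  have hw : C (xhh.1 - xh.1) ∈ LinearMap.ker D ⊓ Uh :=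
    hCRh ▸ Submodule.mem_map_of_mem (Rh.sub_mem hxhh.1 hxh.1)
  obtain ⟨hker, hUh⟩ := Submodule.mem_inf.mp hw
  rw [LinearMap.mem_ker] at hker
  have hmem : memXh Rh Uh Qh Ph ((0, C (xhh.1 - xh.1), 0, 0) : R × U × Q × P) :=
    ⟨Rh.zero_mem, hUh, Qh.zero_mem, Ph.zero_mem⟩
  have heq := (hsolh _ hmem).trans (hsol _ hmem).symm
  simp only [biotForm, biotFormH, hker, map_zero, inner_zero_left, inner_zero_right, mul_zero,
    smul_zero, add_zero, zero_add, sub_zero] at heq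
  rw [← sub_eq_zero, ← inner_sub_left, ← map_sub, inner_self_eq_zero, map_sub, sub_eq_zero] at heq
  exact heq
end
end

section
/- (Invariance of the volumetric strain for decoupled problems, Corollary 5.5) In the abstract four-field Biot setting with the discrete and quadrature settings, assume α = 0. Let f be a linear functional on X, let x_h = (r_h, u_h, q_h, p_h) ∈ X_h satisfy 𝒜(x_h, x̃) = f(x̃) for all x̃ ∈ X_h, and let x̂_h = (r̂_h, û_h, q̂_h, p̂_h) ∈ X_h satisfy 𝒜_h(x̂_h, x̃) = f(x̃) for all x̃ ∈ X_h. Then D û_h = D u_h. -/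
open RealInnerProductSpace

noncomputable section

variable {R U Q P : Type*}
  [NormedAddCommGroup R] [InnerProductSpace ℝ R]
  [NormedAddCommGroup U] [InnerProductSpace ℝ U]
  [NormedAddCommGroup Q] [InnerProductSpace ℝ Q]
  [NormedAddCommGroup P] [InnerProductSpace ℝ P]

/-- If `a ⟪D d, D v⟫ + ⟪w, v⟫` vanishes for all `v` in a subspace containing `d` and
`w ∈ ker D`, and `a ≠ 0`, then `D d = 0`. -/
theorem map_eq_zero_of_forall_inner_add_inner_eq_zero
    {D : U →ₗ[ℝ] P} {Uh : Submodule ℝ U} {a : ℝ} (ha : a ≠ 0) {d w : U}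
    (hd : d ∈ Uh) (hw : w ∈ LinearMap.ker D ⊓ Uh)
    (h : ∀ v ∈ Uh, a * ⟪D d, D v⟫ + ⟪w, v⟫ = 0) : D d = 0 := by
  obtain ⟨hwD, hwU⟩ := Submodule.mem_inf.1 hw
  have hw0 : w = 0 := by
    simpa [LinearMap.mem_ker.1 hwD] using h w hwU
  simpa [hw0, ha] using h d hd

/-- Invariance of the volumetric strain for decoupled problems,
Corollary 5.5: if `α = 0`, `x_h` solves the discrete problem and `x̂_h` the
quadrature-perturbed one, then `D û_h = D u_h`. -/
theorem div_invariance
    (C : R →ₗ[ℝ] U) (D : U →ₗ[ℝ] P) (E : Q →ₗ[ℝ] P)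
    (hrange : LinearMap.range C = LinearMap.ker D)
    (Rh : Submodule ℝ R) (Uh : Submodule ℝ U) (Qh : Submodule ℝ Q) (Ph : Submodule ℝ P)
    (hCRh : Rh.map C = LinearMap.ker D ⊓ Uh)
    (hDUh : Uh.map D = Ph)
    (hEQh : Qh.map E = Ph)
    (bR : R →ₗ[ℝ] R →ₗ[ℝ] ℝ) (bQ : Q →ₗ[ℝ] Q →ₗ[ℝ] ℝ)
    (hbR_symm : ∀ a b : R, bR a b = bR b a) (hbR_psd : ∀ a : R, 0 ≤ bR a a)
    (hbQ_symm : ∀ a b : Q, bQ a b = bQ b a) (hbQ_psd : ∀ a : Q, 0 ≤ bQ a a)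
    (μ lam K δ c₀ α : ℝ) (hμ : 0 < μ) (hlam : 0 < lam) (hK : 0 < K) (hδ : 0 < δ)
    (hc₀ : 0 ≤ c₀)
    (hα : α = 0)
    (f : (R × U × Q × P) →ₗ[ℝ] ℝ)
    (xh xhh : R × U × Q × P)
    (hxh : memXh Rh Uh Qh Ph xh)
    (hsol : ∀ xt : R × U × Q × P, memXh Rh Uh Qh Ph xt →
      biotForm μ lam K δ c₀ α C D E xh xt = f xt)
    (hxhh : memXh Rh Uh Qh Ph xhh)
    (hsolh : ∀ xt : R × U × Q × P, memXh Rh Uh Qh Ph xt →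
      biotFormH μ lam K δ c₀ α C D E bR bQ xhh xt = f xt)
    :
    D xhh.2.1 = D xh.2.1 := by
  subst hα
  obtain ⟨hr, hu, -, -⟩ := hxh
  obtain ⟨hr', hu', -, -⟩ := hxhh
  rw [← sub_eq_zero, ← map_sub]
  have ha : 2 * μ + lam ≠ 0 := by positivity
  refine map_eq_zero_of_forall_inner_add_inner_eq_zero (w := C (xhh.1 - xh.1)) ha
    (Uh.sub_mem hu' hu) (hCRh ▸ Submodule.mem_map_of_mem (Rh.sub_mem hr' hr)) fun v hv => ?_
  have hmem : memXh Rh Uh Qh Ph (0, v, 0, 0) := ⟨Rh.zero_mem, hv, Qh.zero_mem, Ph.zero_mem⟩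
  have h := hsol _ hmem
  have h' := hsolh _ hmem
  simp [biotForm] at h
  simp [biotFormH] at h'
  simp only [map_sub, inner_sub_left]
  linarith
end
end

section
/- (Invariance of the rotation, abstract form of Corollary 5.6) In the abstract four-field Biot setting with the discrete setting and the extended quadrature setting, assume additionally that every ρ ∈ R_h with Cρ = 0 belongs to R̊_h. Let f be a linear functional on X, let x_h = (r_h, u_h, q_h, p_h) ∈ X_h satisfy 𝒜(x_h, x̃) = f(x̃) for all x̃ ∈ X_h, and let x̂_h = (r̂_h, û_h, q̂_h, p̂_h) ∈ X_h satisfy 𝒜_h(x̂_h, x̃) = f(x̃) for all x̃ ∈ X_h. Then r̂_h = r_h. -/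
open RealInnerProductSpace

noncomputable section

variable {R U Q P : Type*}
  [NormedAddCommGroup R] [InnerProductSpace ℝ R]
  [NormedAddCommGroup U] [InnerProductSpace ℝ U]
  [NormedAddCommGroup Q] [InnerProductSpace ℝ Q]
  [NormedAddCommGroup P] [InnerProductSpace ℝ P]

variable {HR HQ : Type*}
  [NormedAddCommGroup HR] [InnerProductSpace ℝ HR]
  [NormedAddCommGroup HQ] [InnerProductSpace ℝ HQ]

/-- The quadrature-perturbed Biot bilinear form `𝒜_h` in the extended quadrature setting,
where `R` and `Q` are embedded isometrically into the ambient spaces `HR` and `HQ` carrying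
the quadrature forms `bR` and `bQ`. -/
def biotFormHE (μ lam K δ c₀ α : ℝ) (C : R →ₗ[ℝ] U) (D : U →ₗ[ℝ] P) (E : Q →ₗ[ℝ] P)
    (ιR : R →ₗᵢ[ℝ] HR) (ιQ : Q →ₗᵢ[ℝ] HQ)
    (bR : HR →ₗ[ℝ] HR →ₗ[ℝ] ℝ) (bQ : HQ →ₗ[ℝ] HQ →ₗ[ℝ] ℝ) (x y : R × U × Q × P) : ℝ :=
  μ⁻¹ * bR (ιR x.1) (ιR y.1) + (2 * μ + lam) * ⟪D x.2.1, D y.2.1⟫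
    + K⁻¹ * bQ (ιQ x.2.2.1) (ιQ y.2.2.1) + c₀ * ⟪x.2.2.2, y.2.2.2⟫
    + ⟪C x.1, y.2.1⟫ + ⟪α • D x.2.1 + δ • E x.2.2.1, y.2.2.2⟫
    - ⟪C y.1, x.2.1⟫ - ⟪α • D y.2.1 + δ • E y.2.2.1, x.2.2.2⟫

/-- Invariance of the rotation, abstract form of Corollary 5.6: if every
element of the kernel of `C` in `R_h` lies in `R̊_h` (so that the quadrature is exact on
it), `x_h` solves the discrete problem and `x̂_h` the quadrature-perturbed one, then
`r̂_h = r_h`. -/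
theorem rotation_invariance
    (C : R →ₗ[ℝ] U) (D : U →ₗ[ℝ] P) (E : Q →ₗ[ℝ] P)
    (hrange : LinearMap.range C = LinearMap.ker D)
    (Rh : Submodule ℝ R) (Uh : Submodule ℝ U) (Qh : Submodule ℝ Q) (Ph : Submodule ℝ P)
    (hCRh : Rh.map C = LinearMap.ker D ⊓ Uh)
    (hDUh : Uh.map D = Ph)
    (hEQh : Qh.map E = Ph)
    (ιR : R →ₗᵢ[ℝ] HR) (ιQ : Q →ₗᵢ[ℝ] HQ)
    (bR : HR →ₗ[ℝ] HR →ₗ[ℝ] ℝ) (bQ : HQ →ₗ[ℝ] HQ →ₗ[ℝ] ℝ)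
    (hbR_symm : ∀ a b : HR, bR a b = bR b a) (hbR_psd : ∀ a : HR, 0 ≤ bR a a)
    (hbQ_symm : ∀ a b : HQ, bQ a b = bQ b a) (hbQ_psd : ∀ a : HQ, 0 ≤ bQ a a)
    (R0h : Submodule ℝ HR) (Q0h : Submodule ℝ HQ)
    (hexactR : ∀ w ∈ Rh.map ιR.toLinearMap ⊔ R0h, ∀ r0 ∈ R0h, bR w r0 = ⟪w, r0⟫)
    (hexactQ : ∀ w ∈ Qh.map ιQ.toLinearMap ⊔ Q0h, ∀ q0 ∈ Q0h, bQ w q0 = ⟪w, q0⟫)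
    (hker : ∀ ρ ∈ Rh, C ρ = 0 → ιR ρ ∈ R0h)
    (μ lam K δ c₀ α : ℝ) (hμ : 0 < μ) (hlam : 0 < lam) (hK : 0 < K) (hδ : 0 < δ)
    (hc₀ : 0 ≤ c₀)
    (f : (R × U × Q × P) →ₗ[ℝ] ℝ)
    (xh xhh : R × U × Q × P)
    (hxh : memXh Rh Uh Qh Ph xh)
    (hsol : ∀ xt : R × U × Q × P, memXh Rh Uh Qh Ph xt →
      biotForm μ lam K δ c₀ α C D E xh xt = f xt)
    (hxhh : memXh Rh Uh Qh Ph xhh)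
    (hsolh : ∀ xt : R × U × Q × P, memXh Rh Uh Qh Ph xt →
      biotFormHE μ lam K δ c₀ α C D E ιR ιQ bR bQ xhh xt = f xt)
    :
    xhh.1 = xh.1 := by
  obtain ⟨hr, -, -, -⟩ := hxh
  obtain ⟨hrh, -, -, -⟩ := hxhh
  have hd : xhh.1 - xh.1 ∈ Rh := Rh.sub_mem hrh hr
  have hCd_mem : C (xhh.1 - xh.1) ∈ LinearMap.ker D ⊓ Uh :=
    hCRh ▸ Submodule.mem_map_of_mem hd
  have hDCd : D (C (xhh.1 - xh.1)) = 0 := hCd_mem.1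
  have hCd : C (xhh.1 - xh.1) = 0 := by
    have hmem : memXh Rh Uh Qh Ph (0, C (xhh.1 - xh.1), 0, 0) :=
      ⟨Rh.zero_mem, hCd_mem.2, Qh.zero_mem, Ph.zero_mem⟩
    have heq := (hsolh _ hmem).trans (hsol _ hmem).symm
    simp only [biotForm, biotFormHE, hDCd, map_zero, inner_zero_left, inner_zero_right,
      smul_zero, mul_zero, add_zero, zero_add, sub_zero] at heq
    rw [← inner_self_eq_zero (𝕜 := ℝ)]
    nth_rewrite 1 [map_sub]
    rw [inner_sub_left, heq, sub_self]
  have hmem : memXh Rh Uh Qh Ph (xhh.1 - xh.1, 0, 0, 0) :=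
    ⟨hd, Uh.zero_mem, Qh.zero_mem, Ph.zero_mem⟩
  have heq := (hsolh _ hmem).trans (hsol _ hmem).symm
  have hexact : bR (ιR xhh.1) (ιR (xhh.1 - xh.1)) = ⟪xhh.1, xhh.1 - xh.1⟫ :=
    (hexactR _ (Submodule.mem_sup_left (Submodule.mem_map_of_mem hrh)) _ (hker _ hd hCd)).trans
      (ιR.inner_map_map _ _)
  simp only [biotForm, biotFormHE, hCd, hexact, map_zero, inner_zero_left, inner_zero_right,
    smul_zero, mul_zero, add_zero, sub_zero] at heq
  rw [← sub_eq_zero, ← inner_self_eq_zero (𝕜 := ℝ), inner_sub_left,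
    mul_left_cancel₀ (inv_ne_zero hμ.ne') heq, sub_self]
end
end

section
/- (Improved rotation estimate, abstract core of Lemma 5.7) In the abstract four-field Biot setting with the discrete setting, let f be a linear functional on X, let x = (r, u, q, p) ∈ X satisfy 𝒜(x, x̃) = f(x̃) for all x̃ ∈ X, and let x_h = (r_h, u_h, q_h, p_h) ∈ X_h satisfy 𝒜(x_h, x̃_h) = f(x̃_h) for all x̃_h ∈ X_h. Suppose ρ* ∈ R_h satisfies the Galerkin orthogonality ⟨C(r − ρ*), C ρ_h⟩ = 0 for all ρ_h ∈ R_h. Then ‖r_h − r‖ ≤ ‖r − ρ*‖. -/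
open RealInnerProductSpace

noncomputable section

variable {R U Q P : Type*}
  [NormedAddCommGroup R] [InnerProductSpace ℝ R]
  [NormedAddCommGroup U] [InnerProductSpace ℝ U]
  [NormedAddCommGroup Q] [InnerProductSpace ℝ Q]
  [NormedAddCommGroup P] [InnerProductSpace ℝ P]

/-- Improved rotation estimate, abstract core of Lemma 5.7: if `x` solves
the continuous problem, `x_h` the discrete one, and `ρ* ∈ R_h` is the Ritz projection of
the exact rotation `r`, i.e. `⟪C(r − ρ*), C ρ_h⟫ = 0` for all `ρ_h ∈ R_h`, then
`‖r_h − r‖ ≤ ‖r − ρ*‖`. -/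
theorem improved_rotation_estimate
    (C : R →ₗ[ℝ] U) (D : U →ₗ[ℝ] P) (E : Q →ₗ[ℝ] P)
    (hrange : LinearMap.range C = LinearMap.ker D)
    (Rh : Submodule ℝ R) (Uh : Submodule ℝ U) (Qh : Submodule ℝ Q) (Ph : Submodule ℝ P)
    (hCRh : Rh.map C = LinearMap.ker D ⊓ Uh)
    (hDUh : Uh.map D = Ph)
    (hEQh : Qh.map E = Ph)
    (Pih : U →ₗ[ℝ] U)
    (hPih_idem : ∀ u : U, Pih (Pih u) = Pih u)
    (hPih_symm : ∀ u v : U, ⟪Pih u, v⟫ = ⟪u, Pih v⟫)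
    (hPih_range : LinearMap.range Pih = Rh.map C)
    (μ lam K δ c₀ α : ℝ) (hμ : 0 < μ) (hlam : 0 < lam) (hK : 0 < K) (hδ : 0 < δ)
    (hc₀ : 0 ≤ c₀)
    (f : (R × U × Q × P) →ₗ[ℝ] ℝ)
    (x xh : R × U × Q × P)
    (hsol : ∀ xt : R × U × Q × P, biotForm μ lam K δ c₀ α C D E x xt = f xt)
    (hxh : memXh Rh Uh Qh Ph xh)
    (hsolh : ∀ xt : R × U × Q × P, memXh Rh Uh Qh Ph xt →
      biotForm μ lam K δ c₀ α C D E xh xt = f xt)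
    (ρs : R) (hρs : ρs ∈ Rh)
    (horth : ∀ ρh ∈ Rh, ⟪C (x.1 - ρs), C ρh⟫ = (0 : ℝ)) :
    ‖xh.1 - x.1‖ ≤ ‖x.1 - ρs‖ := by
  set ρ := xh.1 - ρs with hρ_def
  have hρ : ρ ∈ Rh := Rh.sub_mem hxh.1 hρs
  have hCρ_mem : C ρ ∈ LinearMap.ker D ⊓ Uh := hCRh ▸ Submodule.mem_map_of_mem hρ
  have hDCρ : D (C ρ) = 0 := hCρ_mem.1
  have hC_err : ⟪C xh.1, C ρ⟫ = ⟪C x.1, C ρ⟫ := by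
    have h := (hsolh (0, C ρ, 0, 0) ⟨Rh.zero_mem, hCρ_mem.2, Qh.zero_mem, Ph.zero_mem⟩).trans
      (hsol _).symm
    simpa [biotForm, hDCρ] using h
  have hCρ : C ρ = 0 := by
    have h := horth ρ hρ
    rw [map_sub, inner_sub_left] at h
    have hself : ⟪C ρ, C ρ⟫ = ⟪C xh.1, C ρ⟫ - ⟪C ρs, C ρ⟫ := by
      rw [← inner_sub_left, ← map_sub]
    rwa [← inner_self_eq_zero (𝕜 := ℝ), hself, hC_err]
  have hr_err : ⟪xh.1 - x.1, ρ⟫ = (0 : ℝ) := by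
    have h := (hsolh (ρ, 0, 0, 0) ⟨hρ, Uh.zero_mem, Qh.zero_mem, Ph.zero_mem⟩).trans
      (hsol _).symm
    simp only [biotForm, hCρ, map_zero, inner_zero_left, inner_zero_right, mul_zero, smul_zero,
      add_zero, sub_zero] at h
    rw [inner_sub_left, mul_left_cancel₀ (inv_ne_zero hμ.ne') h, sub_self]
  have hsplit : x.1 - ρs = ρ - (xh.1 - x.1) := by rw [hρ_def]; abel
  have hpyth := norm_sub_sq_eq_norm_sq_add_norm_sq_real ((real_inner_comm _ _).trans hr_err)
  rw [hsplit]
  nlinarith [norm_nonneg (ρ - (xh.1 - x.1)), norm_nonneg (xh.1 - x.1), mul_self_nonneg ‖ρ‖]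
end
end
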